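/- arXiv:1708.06064 — 2 statements merged into one kernel-verified Lean document; each statement's English description precedes it below -/
import Mathlib

section
/- Let T = {(2,7,8),(2,7,9),(3,4,5),(3,4,8),(3,6,8),(3,7,8),(3,7,9),(4,6,7),(4,6,8),(4,6,9),(4,7,8),(4,7,9),(5,6,7),(5,6,8),(5,6,9),(5,7,8),(5,7,9),(5,8,9),(6,7,8),(6,7,9)}. There exist nine points p₁,…,p₉ in the plane and a simple polygon P whose interior contains them, with {p₁,…,p₉} together with the vertices of P in strong general position, such that for all 1 ≤ i < j < k ≤ 9 the triple (p_i, p_j, p_k) is in geodesic counterclockwise order with respect to P if and only if (i,j,k) ∈ T. -/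
open scoped RealInnerProductSpace ENNReal Classical

noncomputable section

/-- Points of the Euclidean plane. -/
abbrev Pt : Type := EuclideanSpace ℝ (Fin 2)

/-- The planar determinant `det (u, v)` of two vectors. -/
def det2 (u v : Pt) : ℝ := u 0 * v 1 - u 1 * v 0

/-- No three of the points of `S` are collinear. -/
def NoThreeCollinear (S : Set Pt) : Prop :=
  ∀ p ∈ S, ∀ q ∈ S, ∀ r ∈ S, p ≠ q → p ≠ r → q ≠ r → det2 (q - p) (r - p) ≠ 0

/-- `S` is in strong general position: no three points are collinear and for any four
distinct points `p₁ p₂ p₃ p₄` the line through `p₁,p₂` is not parallel to the line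
through `p₃,p₄`. -/
def StrongGenPos (S : Set Pt) : Prop :=
  NoThreeCollinear S ∧
    ∀ p₁ ∈ S, ∀ p₂ ∈ S, ∀ p₃ ∈ S, ∀ p₄ ∈ S,
      p₁ ≠ p₂ → p₁ ≠ p₃ → p₁ ≠ p₄ → p₂ ≠ p₃ → p₂ ≠ p₄ → p₃ ≠ p₄ →
        det2 (p₂ - p₁) (p₄ - p₃) ≠ 0

/-- A simple polygon, given by a cyclic sequence of `n ≥ 3` distinct vertices
(encoded as an `n`-periodic function `ℕ → Pt`), such that no point of the plane lies on
more than two closed edges, and the only points lying on exactly two edges are vertices. -/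
structure SimplePolygon where
  n : ℕ
  three_le : 3 ≤ n
  vtx : ℕ → Pt
  periodic : ∀ i, vtx (i + n) = vtx i
  inj : ∀ i < n, ∀ j < n, vtx i = vtx j → i = j
  simple : ∀ x : Pt, {i | i < n ∧ x ∈ segment ℝ (vtx i) (vtx (i + 1))}.ncard ≤ 2
  vtx_of_two : ∀ x : Pt,
    {i | i < n ∧ x ∈ segment ℝ (vtx i) (vtx (i + 1))}.ncard = 2 → ∃ i < n, x = vtx i

namespace SimplePolygon

/-- The boundary of a simple polygon: the union of its closed edges. -/
def boundary (P : SimplePolygon) : Set Pt :=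
  ⋃ i ∈ Finset.range P.n, segment ℝ (P.vtx i) (P.vtx (i + 1))

/-- The interior of a simple polygon: the union of the bounded connected components of the
complement of the boundary. -/
def interior (P : SimplePolygon) : Set Pt :=
  {x | x ∉ P.boundary ∧ Bornology.IsBounded (connectedComponentIn P.boundaryᶜ x)}

/-- A simple polygon, regarded as a point set: boundary together with interior. -/
def region (P : SimplePolygon) : Set Pt := P.boundary ∪ P.interior

/-- The set of vertices of the polygon. -/
def vertexSet (P : SimplePolygon) : Set Pt := {x | ∃ i < P.n, x = P.vtx i}

/-- Twice the shoelace signed area. -/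
def shoelace (P : SimplePolygon) : ℝ := ∑ i ∈ Finset.range P.n, det2 (P.vtx i) (P.vtx (i + 1))

/-- The vertices are listed in counterclockwise order (positive shoelace signed area). -/
def CCW (P : SimplePolygon) : Prop := 0 < P.shoelace

/-- The vertex `vtx (i+1)` is a convex vertex:
`det (v_{i+1} − v_i, v_{i+2} − v_{i+1}) > 0` (vertices listed counterclockwise). -/
def ConvexAt (P : SimplePolygon) (i : ℕ) : Prop :=
  0 < det2 (P.vtx (i + 1) - P.vtx i) (P.vtx (i + 2) - P.vtx (i + 1))

/-- The number of convex vertices of the polygon. -/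
def numConvex (P : SimplePolygon) : ℕ := {i | i < P.n ∧ P.ConvexAt i}.ncard

/-- Continuous paths from `s` to `t` staying inside the polygon. -/
def pathsIn (P : SimplePolygon) (s t : Pt) : Set (ℝ → Pt) :=
  {γ | ContinuousOn γ (Set.Icc 0 1) ∧ γ 0 = s ∧ γ 1 = t ∧ γ '' Set.Icc (0 : ℝ) 1 ⊆ P.region}

/-- The geodesic distance between `s` and `t` inside the polygon: the infimum of the
lengths (total variations) of continuous paths in the polygon from `s` to `t`. -/
def geodDist (P : SimplePolygon) (s t : Pt) : ℝ≥0∞ :=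
  ⨅ γ ∈ P.pathsIn s t, eVariationOn γ (Set.Icc 0 1)

end SimplePolygon

/-- Length of a polygonal path through a list of points. -/
def polylineLen : List Pt → ℝ
  | [] => 0
  | [_] => 0
  | a :: b :: l => dist a b + polylineLen (b :: l)

/-- The polygonal path through a list of points, as a point set. -/
def polylineSet : List Pt → Set Pt
  | [] => ∅
  | [a] => {a}
  | a :: b :: l => segment ℝ a b ∪ polylineSet (b :: l)

/-- `L` is the vertex sequence of the geodesic from `s` to `t` inside the polygon `P`:
a polygonal path inside `P` from `s` to `t`, with consecutive vertices distinct, with no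
three consecutive vertices collinear, whose length realizes the geodesic distance. -/
def SimplePolygon.IsGeodesicChain (P : SimplePolygon) (s t : Pt) (L : List Pt) : Prop :=
  L.head? = some s ∧ L.getLast? = some t ∧ List.Chain' (· ≠ ·) L ∧
  (∀ i, i + 2 < L.length →
      det2 (L.getD (i + 1) 0 - L.getD i 0) (L.getD (i + 2) 0 - L.getD i 0) ≠ 0) ∧
  polylineSet L ⊆ P.region ∧
  ENNReal.ofReal (polylineLen L) = P.geodDist s t

/-- The triple `(p,q,r)` is in geodesic counterclockwise order with respect to `P`:
writing the geodesics `π(p,q) = ⟨p = v₀, …, v_k = q⟩` and `π(p,r) = ⟨p = u₀, …, u_{k'} = r⟩`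
and taking the smallest index `i > 0` with `v_i ≠ u_i`, we have
`det (v_i − v_{i−1}, u_i − v_{i−1}) > 0`. -/
def geodesicCCW (P : SimplePolygon) (p q r : Pt) : Prop :=
  ∃ L M : List Pt, P.IsGeodesicChain p q L ∧ P.IsGeodesicChain p r M ∧
    ∃ i : ℕ, 0 < i ∧ (∀ j < i, L[j]? = M[j]?) ∧ L[i]? ≠ M[i]? ∧
      ∃ a b c : Pt, L[i - 1]? = some a ∧ L[i]? = some b ∧ M[i]? = some c ∧
        0 < det2 (b - a) (c - a)

/-- The triple `(p,q,r)` is in geodesic clockwise order with respect to `P`. -/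
def geodesicCW (P : SimplePolygon) (p q r : Pt) : Prop :=
  ∃ L M : List Pt, P.IsGeodesicChain p q L ∧ P.IsGeodesicChain p r M ∧
    ∃ i : ℕ, 0 < i ∧ (∀ j < i, L[j]? = M[j]?) ∧ L[i]? ≠ M[i]? ∧
      ∃ a b c : Pt, L[i - 1]? = some a ∧ L[i]? = some b ∧ M[i]? = some c ∧
        det2 (b - a) (c - a) < 0

/-- `C ⊆ P` is geodesically convex: for all `p, q ∈ C` the geodesic connecting them
stays inside `C`. -/
def GeodesicallyConvex (P : SimplePolygon) (C : Set Pt) : Prop :=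
  C ⊆ P.region ∧ ∀ p ∈ C, ∀ q ∈ C, ∀ L, P.IsGeodesicChain p q L → polylineSet L ⊆ C

/-- The geodesic hull `CH_P(U)`: the intersection of all geodesically convex subsets of `P`
containing `U`. -/
def geodesicHull (P : SimplePolygon) (U : Set Pt) : Set Pt :=
  ⋂₀ {C | GeodesicallyConvex P C ∧ U ⊆ C}

/-- `E_P(S)`: the set of points of `S` lying on the (topological) boundary of the geodesic
hull of `S` with respect to `P`. -/
def extremeSet (P : SimplePolygon) (S : Set Pt) : Set Pt :=
  {x ∈ S | x ∈ frontier (geodesicHull P S)}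

/-- `B` is separable from `R`: there is a simple polygon with at most `|B|` convex vertices
whose interior contains all points of `R` and which contains no point of `B`. -/
def Separable (B R : Finset Pt) : Prop :=
  ∃ P : SimplePolygon, P.CCW ∧ P.numConvex ≤ B.card ∧
    (∀ r ∈ R, r ∈ P.interior) ∧ ∀ b ∈ B, b ∉ P.region

/-- The ascending counterclockwise triples of the non-Pappus abstract order type
(standard labeling). -/
def nonPappusCCW : Set (ℕ × ℕ × ℕ) :=
  {(2,7,8),(2,7,9),(3,4,5),(3,4,8),(3,6,8),(3,7,8),(3,7,9),(4,6,7),(4,6,8),(4,6,9),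
   (4,7,8),(4,7,9),(5,6,7),(5,6,8),(5,6,9),(5,7,8),(5,7,9),(5,8,9),(6,7,8),(6,7,9)}


/-! ### Determinants, segments and the visibility estimate -/

lemma det2_eq_zero_of_wbtw {a b c : Pt} (h : Wbtw ℝ a b c) : det2 (b - a) (c - a) = 0 := by
  obtain ⟨t, -, rfl⟩ := h
  simp only [det2, AffineMap.lineMap_apply, vsub_eq_sub, vadd_eq_add, PiLp.sub_apply,
    PiLp.add_apply, PiLp.smul_apply, smul_eq_mul]
  ring

lemma det2_eq_zero_of_wbtw_of_wbtw {p a w q : Pt} (h₁ : Wbtw ℝ p a w) (h₂ : Wbtw ℝ a w q)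
    (hne : a ≠ w) : det2 (a - p) (q - p) = 0 := by
  refine det2_eq_zero_of_wbtw ?_
  exact h₁.trans_expand_left h₂ hne

lemma det2_swap_ends (p b q : Pt) : det2 (b - p) (q - p) = - det2 (b - q) (p - q) := by
  simp only [det2, PiLp.sub_apply]
  ring

lemma dist_add_dist_le_of_mem_segment {p q y x w : Pt} (hy : y ∈ segment ℝ p q)
    (hw : w ∈ segment ℝ y x) : dist p w + dist w q ≤ dist p x + dist x q := by
  have hpq : dist p y + dist y q = dist p q := dist_add_dist_of_mem_segment hy
  have htri := dist_triangle p x q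
  obtain ⟨a, b, ha, hb, hab, rfl⟩ := hw
  have h₁ := (convexOn_dist p (convex_univ (𝕜 := ℝ))).2 (Set.mem_univ y) (Set.mem_univ x) ha hb hab
  have h₂ := (convexOn_dist q (convex_univ (𝕜 := ℝ))).2 (Set.mem_univ y) (Set.mem_univ x) ha hb hab
  simp only [smul_eq_mul, dist_comm _ p] at h₁ h₂
  obtain rfl : b = 1 - a := by linarith
  nlinarith

lemma eq_of_dist_add_dist_le_of_mem_segment {p q y x w : Pt} (hy : y ∈ segment ℝ p q)
    (hw : w ∈ segment ℝ y x) (hpq : w ∉ segment ℝ p q)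
    (hle : dist p x + dist x q ≤ dist p w + dist w q) : x = w := by
  have hpy : dist p y + dist y q = dist p q := dist_add_dist_of_mem_segment hy
  have hlt : dist p q < dist p w + dist w q := by
    refine lt_of_le_of_ne (dist_triangle p w q) fun h => hpq ?_
    exact mem_segment_iff_wbtw.2 (dist_add_dist_eq_iff.1 h.symm)
  obtain ⟨a, b, ha, hb, hab, rfl⟩ := hw
  have h₁ := (convexOn_dist p (convex_univ (𝕜 := ℝ))).2 (Set.mem_univ y) (Set.mem_univ x) ha hb hab
  have h₂ := (convexOn_dist q (convex_univ (𝕜 := ℝ))).2 (Set.mem_univ y) (Set.mem_univ x) ha hb hab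
  simp only [smul_eq_mul, dist_comm _ p] at h₁ h₂
  rcases ha.eq_or_lt with rfl | ha
  · obtain rfl : b = 1 := by linarith
    simp
  · exfalso
    obtain rfl : b = 1 - a := by linarith
    nlinarith

/-! ### Polygonal paths as lists of points -/

lemma polylineLen_nonneg : ∀ L : List Pt, 0 ≤ polylineLen L
  | [] => le_rfl
  | [_] => le_rfl
  | _ :: b :: l => add_nonneg dist_nonneg (polylineLen_nonneg (b :: l))

lemma dist_le_polylineLen : ∀ (L : List Pt) (a b : Pt), L.head? = some a →
    L.getLast? = some b → dist a b ≤ polylineLen L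
  | [], _, _, h, _ => by simp at h
  | [c], a, b, h, h' => by
      simp only [List.head?_cons, List.getLast?_singleton, Option.some.injEq] at h h'
      simp [← h, ← h', polylineLen]
  | c :: d :: l, a, b, h, h' => by
      simp only [List.head?_cons, Option.some.injEq] at h
      subst h
      rw [List.getLast?_cons_cons] at h'
      have := dist_le_polylineLen (d :: l) d b rfl h'
      have := dist_triangle c d b
      simp only [polylineLen]
      linarith

lemma polylineLen_append (a b : Pt) (l₂ : List Pt) : ∀ l₁ : List Pt,
    polylineLen (l₁ ++ a :: b :: l₂) =
      polylineLen (l₁ ++ [a]) + dist a b + polylineLen (b :: l₂)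
  | [] => by simp [polylineLen]
  | [c] => by simp [polylineLen, add_assoc]
  | c :: d :: l => by
      have := polylineLen_append a b l₂ (d :: l)
      simp only [List.cons_append, polylineLen] at this ⊢
      rw [this]
      ring

lemma segment_subset_polylineSet (a b : Pt) (l₂ : List Pt) : ∀ l₁ : List Pt,
    segment ℝ a b ⊆ polylineSet (l₁ ++ a :: b :: l₂)
  | [] => Set.subset_union_left
  | [_] => Set.subset_union_left.trans Set.subset_union_right
  | _ :: d :: l =>
      (segment_subset_polylineSet a b l₂ (d :: l)).trans Set.subset_union_right

/-- No three consecutive points of the list are collinear. -/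
def Bends (L : List Pt) : Prop :=
  ∀ l₁ a b c l₂, L = l₁ ++ a :: b :: c :: l₂ → det2 (b - a) (c - a) ≠ 0

lemma bends_of_getD {L : List Pt} (h : ∀ i, i + 2 < L.length →
    det2 (L.getD (i + 1) 0 - L.getD i 0) (L.getD (i + 2) 0 - L.getD i 0) ≠ 0) : Bends L := by
  rintro l₁ a b c l₂ rfl
  have := h l₁.length (by simp)
  simpa [List.getD_eq_getElem?_getD, List.getElem?_append_right] using this

lemma Bends.of_append_left {l l' : List Pt} (h : Bends (l ++ l')) : Bends l := by
  rintro l₁ a b c l₂ rfl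
  exact h l₁ a b c (l₂ ++ l') (by simp)

lemma Bends.of_append_right {l l' : List Pt} (h : Bends (l ++ l')) : Bends l' := by
  rintro l₁ a b c l₂ rfl
  exact h (l ++ l₁) a b c l₂ (by simp)

lemma Bends.eq_of_polylineLen_le {L : List Pt} {p q : Pt} (hL : Bends L)
    (hp : L.head? = some p) (hq : L.getLast? = some q) (hlen : polylineLen L ≤ dist p q) :
    (L = [p] ∧ p = q) ∨ L = [p, q] := by
  match L, hL, hp, hq, hlen with
  | [], _, h, _, _ => simp at h
  | [a], _, h, h', _ => simp_all
  | [a, b], _, h, h', _ => simp_all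
  | a :: b :: c :: l, hL, h, h', hlen =>
    exfalso
    simp only [List.head?_cons, Option.some.injEq] at h
    subst h
    rw [List.getLast?_cons_cons, List.getLast?_cons_cons] at h'
    have h₁ := dist_le_polylineLen (c :: l) c q rfl h'
    have h₂ := dist_triangle a c q
    have h₃ := dist_triangle a b c
    simp only [polylineLen] at hlen
    refine hL [] a b c l rfl (det2_eq_zero_of_wbtw (dist_add_dist_eq_iff.1 ?_))
    linarith

lemma exists_mem_segment_coord_eq_zero {a b : Pt} (h : a 0 * b 0 ≤ 0) :
    ∃ x ∈ segment ℝ a b, x 0 = 0 := by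
  by_cases hab : b 0 - a 0 = 0
  · refine ⟨a, left_mem_segment ℝ a b, ?_⟩
    have : b 0 = a 0 := by linarith
    rw [this] at h
    nlinarith
  · have hpos : 0 < (b 0 - a 0) ^ 2 := by positivity
    refine ⟨(b 0 / (b 0 - a 0)) • a + (-a 0 / (b 0 - a 0)) • b,
      ⟨_, _, ?_, ?_, ?_, rfl⟩, ?_⟩
    · rw [show b 0 / (b 0 - a 0) = b 0 * (b 0 - a 0) / (b 0 - a 0) ^ 2 by field_simp]
      exact div_nonneg (by nlinarith) hpos.le
    · rw [show -a 0 / (b 0 - a 0) = -a 0 * (b 0 - a 0) / (b 0 - a 0) ^ 2 by field_simp]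
      exact div_nonneg (by nlinarith) hpos.le
    · field_simp
      ring
    · simp only [PiLp.add_apply, PiLp.smul_apply, smul_eq_mul]
      field_simp
      ring

lemma exists_crossing_edge : ∀ (L : List Pt) (p q : Pt), L.head? = some p →
    L.getLast? = some q → p 0 * q 0 < 0 →
    ∃ l₁ a b l₂, L = l₁ ++ a :: b :: l₂ ∧ ∃ x ∈ segment ℝ a b, x 0 = 0
  | [], _, _, h, _, _ => by simp at h
  | [c], p, q, h, h', hpq => by
      simp only [List.head?_cons, List.getLast?_singleton, Option.some.injEq] at h h'
      subst h h'
      nlinarith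
  | c :: d :: l, p, q, h, h', hpq => by
      simp only [List.head?_cons, Option.some.injEq] at h
      subst h
      rw [List.getLast?_cons_cons] at h'
      by_cases hcd : c 0 * d 0 ≤ 0
      · exact ⟨[], c, d, l, rfl, exists_mem_segment_coord_eq_zero hcd⟩
      · have hdq : d 0 * q 0 < 0 := by
          push Not at hcd
          have : 0 < c 0 * d 0 * (c 0 * d 0) := mul_pos hcd hcd
          by_contra hneg
          push Not at hneg
          have : (c 0 * q 0) * (c 0 * d 0) < 0 := mul_neg_of_neg_of_pos hpq hcd
          nlinarith [mul_nonneg hneg (sq_nonneg (c 0))]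
        obtain ⟨l₁, a, b, l₂, e, hx⟩ := exists_crossing_edge (d :: l) d q rfl h' hdq
        exact ⟨c :: l₁, a, b, l₂, by rw [e]; rfl, hx⟩

/-! ### Geodesic distances -/

lemma eVariationOn_lineMap_comp_le (a b : Pt) (f : ℝ → ℝ) {s t : ℝ} (hf : Monotone f)
    (hst : s ≤ t) :
    eVariationOn (fun u => AffineMap.lineMap a b (f u) : ℝ → Pt) (Set.Icc s t) ≤
      ENNReal.ofReal (dist a b * (f t - f s)) := by
  have hl : LipschitzOnWith (nndist a b) (AffineMap.lineMap a b : ℝ → Pt) Set.univ :=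
    (lipschitzWith_lineMap a b).lipschitzOnWith
  have h₁ := hl.comp_eVariationOn_le (f := (AffineMap.lineMap a b : ℝ → Pt)) (g := f)
    (s := Set.Icc s t) (Set.mapsTo_univ _ _)
  have h₂ := (hf.monotoneOn (Set.Icc s t)).eVariationOn_eq
    (Set.left_mem_Icc.2 hst) (Set.right_mem_Icc.2 hst)
  rw [Set.inter_self] at h₂
  refine h₁.trans ((mul_le_mul_right h₂.le _).trans_eq ?_)
  rw [ENNReal.ofReal_mul dist_nonneg, ← coe_nndist, ENNReal.ofReal_coe_nnreal]

lemma SimplePolygon.geodDist_le (P : SimplePolygon) {a b c : Pt}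
    (h₁ : segment ℝ a b ⊆ P.region) (h₂ : segment ℝ b c ⊆ P.region) :
    P.geodDist a c ≤ ENNReal.ofReal (dist a b + dist b c) := by
  set γ : ℝ → Pt := fun u =>
    if u ≤ 1 / 2 then AffineMap.lineMap a b (2 * u) else AffineMap.lineMap b c (2 * u - 1) with hγ
  have e₁ : Set.EqOn γ (fun u => AffineMap.lineMap a b (2 * u)) (Set.Icc 0 (1 / 2)) :=
    fun u hu => if_pos hu.2
  have e₂ : Set.EqOn γ (fun u => AffineMap.lineMap b c (2 * u - 1)) (Set.Icc (1 / 2) 1) := by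
    intro u hu
    by_cases h : u ≤ 1 / 2
    · obtain rfl : u = 1 / 2 := le_antisymm h hu.1
      simp [hγ]
    · exact if_neg h
  have hmem : γ ∈ P.pathsIn a c := by
    refine ⟨Continuous.continuousOn ?_, ?_, ?_, ?_⟩
    · refine Continuous.if_le ?_ ?_ continuous_id continuous_const ?_
      · exact (AffineMap.lineMap_continuous).comp (by fun_prop)
      · exact (AffineMap.lineMap_continuous).comp (by fun_prop)
      · rintro u rfl
        simp
    · rw [e₁ (by norm_num)]
      simp
    · rw [e₂ (by norm_num)]
      norm_num
    · rintro _ ⟨u, hu, rfl⟩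
      rcases le_total u (1 / 2) with h | h
      · rw [e₁ ⟨hu.1, h⟩]
        apply h₁
        rw [segment_eq_image_lineMap]
        exact ⟨2 * u, ⟨by linarith [hu.1], by linarith⟩, rfl⟩
      · rw [e₂ ⟨h, hu.2⟩]
        apply h₂
        rw [segment_eq_image_lineMap]
        exact ⟨2 * u - 1, ⟨by linarith, by linarith [hu.2]⟩, rfl⟩
  refine (iInf₂_le γ hmem).trans ?_
  have hsplit := eVariationOn.Icc_add_Icc γ (s := Set.univ) (a := 0) (b := 1 / 2) (c := 1)
    (by norm_num) (by norm_num) (Set.mem_univ _)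
  simp only [Set.univ_inter] at hsplit
  rw [← hsplit, eVariationOn.congr e₁, eVariationOn.congr e₂,
    ENNReal.ofReal_add dist_nonneg dist_nonneg]
  refine add_le_add ?_ ?_
  · refine (eVariationOn_lineMap_comp_le a b (fun u => 2 * u) ?_ (by norm_num)).trans_eq ?_
    · intro u v h
      dsimp only
      linarith
    · norm_num
  · refine (eVariationOn_lineMap_comp_le b c (fun u => 2 * u - 1) ?_ (by norm_num)).trans_eq ?_
    · intro u v h
      dsimp only
      linarith
    · norm_num

lemma edist_add_edist_le_eVariationOn (γ : ℝ → Pt) {t : ℝ} (ht : t ∈ Set.Icc (0 : ℝ) 1) :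
    edist (γ 0) (γ t) + edist (γ t) (γ 1) ≤ eVariationOn γ (Set.Icc 0 1) := by
  have hsplit := eVariationOn.Icc_add_Icc γ (s := Set.univ) ht.1 ht.2 (Set.mem_univ _)
  simp only [Set.univ_inter] at hsplit
  rw [← hsplit]
  exact add_le_add
    (eVariationOn.edist_le _ (Set.left_mem_Icc.2 ht.1) (Set.right_mem_Icc.2 ht.1))
    (eVariationOn.edist_le _ (Set.left_mem_Icc.2 ht.2) (Set.right_mem_Icc.2 ht.2))

lemma SimplePolygon.geodDist_eq_of_segment_subset (P : SimplePolygon) {a b : Pt}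
    (h : segment ℝ a b ⊆ P.region) : P.geodDist a b = ENNReal.ofReal (dist a b) := by
  refine le_antisymm ?_ ?_
  · have ha : segment ℝ a a ⊆ P.region := by
      rw [segment_same, Set.singleton_subset_iff]
      exact h (left_mem_segment ℝ a b)
    simpa using P.geodDist_le ha h
  · refine le_iInf₂ fun γ hγ => ?_
    obtain ⟨-, h0, h1, -⟩ := hγ
    rw [← edist_dist, ← h0, ← h1]
    exact eVariationOn.edist_le _ (by norm_num) (by norm_num)

/-- If the geodesic distance is the Euclidean one, the geodesic is the segment. -/
lemma SimplePolygon.isGeodesicChain_iff_of_segment_subset (P : SimplePolygon) {p q : Pt}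
    (hpq : p ≠ q) (h : segment ℝ p q ⊆ P.region) (L : List Pt) :
    P.IsGeodesicChain p q L ↔ L = [p, q] := by
  constructor
  · rintro ⟨hp, hq, -, hb, -, hlen⟩
    rw [P.geodDist_eq_of_segment_subset h,
      ENNReal.ofReal_eq_ofReal_iff (polylineLen_nonneg L) dist_nonneg] at hlen
    rcases (bends_of_getD hb).eq_of_polylineLen_le hp hq hlen.le with h | h
    · exact absurd h.2 hpq
    · exact h
  · rintro rfl
    refine ⟨rfl, rfl, List.isChain_pair.2 hpq, ?_, ?_, ?_⟩
    · intro i hi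
      simp at hi
    · refine Set.union_subset h ?_
      simp only [polylineSet, Set.singleton_subset_iff]
      exact h (right_mem_segment ℝ p q)
    · rw [P.geodDist_eq_of_segment_subset h]
      simp [polylineLen]

section Spike

variable (P : SimplePolygon) {p q w : Pt}

/-- The segment `pq` meets the vertical axis strictly below the point `w` of the axis. -/
def PassesBelow (w p q : Pt) : Prop :=
  p 0 * q 0 < 0 ∧ ∃ y ∈ segment ℝ p q, y 0 = 0 ∧ y 1 < w 1

lemma mem_segment_of_axis {w x y : Pt} (hw : w 0 = 0) (hx : x 0 = 0) (hy : y 0 = 0)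
    (hyw : y 1 < w 1) (hwx : w 1 ≤ x 1) : w ∈ segment ℝ y x := by
  have hpos : 0 < x 1 - y 1 := by linarith
  refine ⟨(x 1 - w 1) / (x 1 - y 1), (w 1 - y 1) / (x 1 - y 1),
    div_nonneg (by linarith) hpos.le, div_nonneg (by linarith) hpos.le, ?_, ?_⟩
  · field_simp
    ring
  · ext i
    fin_cases i
    · simp [hw, hx, hy]
    · simp only [Fin.mk_one, PiLp.add_apply, PiLp.smul_apply, smul_eq_mul]
      field_simp
      ring

lemma SimplePolygon.geodDist_eq_of_passesBelow (hw : w 0 = 0)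
    (haxis : ∀ x ∈ P.region, x 0 = 0 → w 1 ≤ x 1) (h : PassesBelow w p q)
    (hpw : segment ℝ p w ⊆ P.region) (hwq : segment ℝ w q ⊆ P.region) :
    P.geodDist p q = ENNReal.ofReal (dist p w + dist w q) := by
  refine le_antisymm (P.geodDist_le hpw hwq) (le_iInf₂ fun γ hγ => ?_)
  obtain ⟨hc, h0, h1, hr⟩ := hγ
  obtain ⟨hs, y, hy, hy0, hy1⟩ := h
  have hc' : ContinuousOn (fun t => γ t 0) (Set.uIcc (0 : ℝ) 1) := by
    rw [Set.uIcc_of_le zero_le_one]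
    exact (PiLp.continuous_apply 2 (fun _ => ℝ) (0 : Fin 2)).comp_continuousOn hc
  have hmem : (0 : ℝ) ∈ Set.uIcc (γ 0 0) (γ 1 0) := by
    rw [h0, h1, Set.mem_uIcc]
    rcases mul_neg_iff.1 hs with h | h
    · exact Or.inr ⟨h.2.le, h.1.le⟩
    · exact Or.inl ⟨h.1.le, h.2.le⟩
  obtain ⟨t, ht, ht0⟩ := intermediate_value_uIcc hc' hmem
  rw [Set.uIcc_of_le zero_le_one] at ht
  have hx := haxis (γ t) (hr ⟨t, ht, rfl⟩) ht0
  refine le_trans ?_ (edist_add_edist_le_eVariationOn γ ht)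
  rw [h0, h1, edist_dist, edist_dist, ← ENNReal.ofReal_add dist_nonneg dist_nonneg]
  exact ENNReal.ofReal_le_ofReal
    (dist_add_dist_le_of_mem_segment hy (mem_segment_of_axis hw ht0 hy0 hy1 hx))

/-- If the segment `pq` passes below the spike tip `w`, the geodesic bends exactly at `w`. -/
lemma SimplePolygon.isGeodesicChain_iff_of_passesBelow (hw : w 0 = 0)
    (haxis : ∀ x ∈ P.region, x 0 = 0 → w 1 ≤ x 1) (h : PassesBelow w p q)
    (hpw : segment ℝ p w ⊆ P.region) (hwq : segment ℝ w q ⊆ P.region)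
    (hdet : det2 (w - p) (q - p) ≠ 0) (L : List Pt) :
    P.IsGeodesicChain p q L ↔ L = [p, w, q] := by
  have hD := P.geodDist_eq_of_passesBelow hw haxis h hpw hwq
  constructor
  · rintro ⟨hp, hq, -, hb, hset, hlen⟩
    rw [hD, ENNReal.ofReal_eq_ofReal_iff (polylineLen_nonneg L) (by positivity)] at hlen
    have hbends := bends_of_getD hb
    have hwpq : w ∉ segment ℝ p q := fun hmem =>
      hdet (det2_eq_zero_of_wbtw (mem_segment_iff_wbtw.1 hmem))
    obtain ⟨hs, y, hy, hy0, hy1⟩ := h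
    obtain ⟨l₁, a, b, l₂, rfl, x, hxab, hx0⟩ := exists_crossing_edge L p q hp hq hs
    have hx1 := haxis x (hset (segment_subset_polylineSet a b l₂ l₁ hxab)) hx0
    have hwx := mem_segment_of_axis hw hx0 hy0 hy1 hx1
    have hp' : (l₁ ++ [a]).head? = some p := by
      cases l₁ <;> simpa using hp
    have hq' : (b :: l₂).getLast? = some q := by
      rw [← hq]
      simp [List.getLast?_append, List.getLast?_cons]
    have hlast : (l₁ ++ [a]).getLast? = some a := by simp
    have t₁ := dist_le_polylineLen _ p a hp' hlast
    have t₂ := dist_le_polylineLen _ b q rfl hq'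
    have t₃ := dist_add_dist_of_mem_segment hxab
    have t₄ := dist_triangle p a x
    have t₅ := dist_triangle x b q
    have t₆ := dist_add_dist_le_of_mem_segment hy hwx
    rw [polylineLen_append] at hlen
    obtain rfl : x = w :=
      eq_of_dist_add_dist_le_of_mem_segment hy hwx hwpq (by linarith)
    have hpa : Wbtw ℝ p a x := dist_add_dist_eq_iff.1 (by linarith)
    have hbq : Wbtw ℝ x b q := dist_add_dist_eq_iff.1 (by linarith)
    have hab : Wbtw ℝ a x b := mem_segment_iff_wbtw.1 hxab
    have c₁ := (Bends.of_append_left (l := l₁ ++ [a]) (l' := b :: l₂)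
      (by simpa using hbends)).eq_of_polylineLen_le hp' hlast (by linarith)
    have c₂ := (Bends.of_append_right (l := l₁ ++ [a]) (l' := b :: l₂)
      (by simpa using hbends)).eq_of_polylineLen_le rfl hq' (by linarith)
    have c₁' : (l₁ = [] ∧ p = a) ∨ l₁ = [p] := by
      rcases c₁ with ⟨h, rfl⟩ | h
      · left
        simpa using h
      · right
        exact List.append_cancel_right (h.trans (by rfl : [p, a] = [p] ++ [a]))
    have c₂' : (l₂ = [] ∧ b = q) ∨ l₂ = [q] := by
      rcases c₂ with ⟨h, rfl⟩ | h
      · left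
        simpa using h
      · right
        simpa using h
    rcases c₁' with ⟨rfl, rfl⟩ | rfl <;> rcases c₂' with ⟨rfl, rfl⟩ | rfl
    · exact absurd hxab hwpq
    · by_cases hbx : b = x
      · subst hbx
        rfl
      · refine absurd ?_ (hbends [] p b q [] rfl)
        rw [det2_swap_ends, det2_eq_zero_of_wbtw_of_wbtw hbq.symm hab.symm hbx, neg_zero]
    · by_cases hax : a = x
      · subst hax
        rfl
      · exact absurd (det2_eq_zero_of_wbtw_of_wbtw hpa hab hax) (hbends [] p a b [] rfl)
    · by_cases hax : a = x
      · subst hax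
        exact absurd (det2_eq_zero_of_wbtw hbq) (hbends [p] a b q [] rfl)
      · exact absurd (det2_eq_zero_of_wbtw_of_wbtw hpa hab hax) (hbends [] p a b [q] rfl)
  · rintro rfl
    have hne₁ : p ≠ w := by
      rintro rfl
      simp [det2] at hdet
    have hne₂ : w ≠ q := by
      rintro rfl
      apply hdet
      simp only [det2]
      ring
    refine ⟨rfl, rfl, List.isChain_cons_cons.2 ⟨hne₁, List.isChain_pair.2 hne₂⟩, ?_, ?_, ?_⟩
    · intro i hi
      obtain rfl : i = 0 := by
        simp only [List.length_cons, List.length_nil] at hi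
        omega
      simpa using hdet
    · refine Set.union_subset hpw (Set.union_subset hwq ?_)
      simp only [polylineSet, Set.singleton_subset_iff]
      exact hwq (right_mem_segment ℝ w q)
    · rw [hD]
      simp [polylineLen]

end Spike

lemma geodesicCCW_iff {P : SimplePolygon} {p q r : Pt} {L M : List Pt}
    (hL : ∀ L', P.IsGeodesicChain p q L' ↔ L' = L) (hM : ∀ M', P.IsGeodesicChain p r M' ↔ M' = M)
    {i : ℕ} (hi : 0 < i) (hpre : ∀ j < i, L[j]? = M[j]?) {a b c : Pt}
    (ha : L[i - 1]? = some a) (hb : L[i]? = some b) (hc : M[i]? = some c) (hbc : b ≠ c) :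
    geodesicCCW P p q r ↔ 0 < det2 (b - a) (c - a) := by
  have hne : L[i]? ≠ M[i]? := by
    rw [hb, hc]
    simpa using hbc
  constructor
  · rintro ⟨L', M', hL', hM', k, hk, hpre', hne', a', b', c', ha', hb', hc', h⟩
    obtain rfl := (hL L').1 hL'
    obtain rfl := (hM M').1 hM'
    have hki : k = i := by
      rcases lt_trichotomy k i with h | h | h
      · exact absurd (hpre k h) hne'
      · exact h
      · exact absurd (hpre' i h) hne
    subst hki
    rw [ha, Option.some.injEq] at ha'
    rw [hb, Option.some.injEq] at hb'
    rw [hc, Option.some.injEq] at hc'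
    rwa [ha', hb', hc']
  · intro h
    exact ⟨L, M, (hL L).2 rfl, (hM M).2 rfl, i, hi, hpre, hne, a, b, c, ha, hb, hc, h⟩

/-! ### A quadrilateral with one reflex vertex -/

/-- A point of the integer lattice, as a point of the plane. -/
def latticePt (a : ℤ × ℤ) : Pt := !₂[(a.1 : ℝ), (a.2 : ℝ)]

@[simp] lemma latticePt_zero (a : ℤ × ℤ) : latticePt a 0 = a.1 := rfl

@[simp] lemma latticePt_one (a : ℤ × ℤ) : latticePt a 1 = a.2 := rfl

/-- The integer determinant of `b - a` and `d - c`. -/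
def detZ (a b c d : ℤ × ℤ) : ℤ := (b.1 - a.1) * (d.2 - c.2) - (b.2 - a.2) * (d.1 - c.1)

lemma det2_latticePt (a b c d : ℤ × ℤ) :
    det2 (latticePt b - latticePt a) (latticePt d - latticePt c) = detZ a b c d := by
  simp [det2, detZ]

/-- The nine points (indices `1` to `9`), and the vertices of the quadrilateral
(indices `10` to `13`, in counterclockwise order, index `11` being the reflex vertex). -/
def nodes : ℕ → ℤ × ℤ
  | 1 => (40, -18)
  | 2 => (7, -4)
  | 3 => (-33, -32)
  | 4 => (-8, 3)
  | 5 => (-20, 8)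
  | 6 => (-2, 1)
  | 7 => (11, -2)
  | 8 => (-5, 8)
  | 9 => (19, 22)
  | 10 => (-41, -43)
  | 11 => (0, 0)
  | 12 => (58, -35)
  | _ => (0, 59)

lemma mem_segment_latticePt {a b : ℤ × ℤ} {x : Pt} :
    x ∈ segment ℝ (latticePt a) (latticePt b) ↔
      ∃ t : ℝ, 0 ≤ t ∧ t ≤ 1 ∧ x 0 = a.1 + t * (b.1 - a.1) ∧ x 1 = a.2 + t * (b.2 - a.2) := by
  rw [segment_eq_image_lineMap]
  constructor
  · rintro ⟨t, ht, rfl⟩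
    refine ⟨t, ht.1, ht.2, ?_, ?_⟩ <;>
      simp [AffineMap.lineMap_apply] <;> ring
  · rintro ⟨t, h0, h1, e0, e1⟩
    refine ⟨t, ⟨h0, h1⟩, ?_⟩
    ext i
    fin_cases i
    · simp [AffineMap.lineMap_apply, e0]
      ring
    · simp [AffineMap.lineMap_apply, e1]
      ring

lemma latticePt_injective : Function.Injective latticePt := by
  intro a b h
  have h0 : latticePt a 0 = latticePt b 0 := by rw [h]
  have h1 : latticePt a 1 = latticePt b 1 := by rw [h]
  simp only [latticePt_zero, latticePt_one, Int.cast_inj] at h0 h1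
  exact Prod.ext h0 h1

/-- The `i`-th vertex of the quadrilateral. -/
def dartVtx (i : ℕ) : Pt := latticePt (nodes (10 + i % 4))

/-- The `i`-th edge of the quadrilateral. -/
def dartEdge (i : ℕ) : Set Pt := segment ℝ (dartVtx i) (dartVtx (i + 1))

lemma mem_dartEdge_zero {x : Pt} :
    x ∈ dartEdge 0 ↔ ∃ t : ℝ, 0 ≤ t ∧ t ≤ 1 ∧ x 0 = -41 + t * 41 ∧ x 1 = -43 + t * 43 := by
  simp [dartEdge, dartVtx, mem_segment_latticePt, nodes]

lemma mem_dartEdge_one {x : Pt} :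
    x ∈ dartEdge 1 ↔ ∃ t : ℝ, 0 ≤ t ∧ t ≤ 1 ∧ x 0 = t * 58 ∧ x 1 = -(t * 35) := by
  simp [dartEdge, dartVtx, mem_segment_latticePt, nodes]

lemma mem_dartEdge_two {x : Pt} :
    x ∈ dartEdge 2 ↔
      ∃ t : ℝ, 0 ≤ t ∧ t ≤ 1 ∧ x 0 = 58 + -(t * 58) ∧ x 1 = -35 + t * (59 + 35) := by
  simp [dartEdge, dartVtx, mem_segment_latticePt, nodes]

lemma mem_dartEdge_three {x : Pt} :
    x ∈ dartEdge 3 ↔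
      ∃ t : ℝ, 0 ≤ t ∧ t ≤ 1 ∧ x 0 = -(t * 41) ∧ x 1 = 59 + t * (-43 - 59) := by
  simp [dartEdge, dartVtx, mem_segment_latticePt, nodes]

lemma dartEdge_zero_two {x : Pt} (h₀ : x ∈ dartEdge 0) (h₂ : x ∈ dartEdge 2) : False := by
  obtain ⟨s, hs0, hs1, e0, e1⟩ := mem_dartEdge_zero.1 h₀
  obtain ⟨t, ht0, ht1, f0, f1⟩ := mem_dartEdge_two.1 h₂
  linarith

lemma dartEdge_one_three {x : Pt} (h₁ : x ∈ dartEdge 1) (h₃ : x ∈ dartEdge 3) : False := by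
  obtain ⟨s, hs0, hs1, e0, e1⟩ := mem_dartEdge_one.1 h₁
  obtain ⟨t, ht0, ht1, f0, f1⟩ := mem_dartEdge_three.1 h₃
  linarith

lemma eq_latticePt {x : Pt} {a : ℤ × ℤ} (h0 : x 0 = a.1) (h1 : x 1 = a.2) : x = latticePt a := by
  ext i
  fin_cases i
  · exact h0
  · exact h1

lemma eq_dartVtx_of_mem {x : Pt} {i : ℕ} (hi : i < 4) (h : x ∈ dartEdge i)
    (h' : x ∈ dartEdge ((i + 1) % 4)) : x = dartVtx ((i + 1) % 4) := by
  interval_cases i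
  · obtain ⟨s, hs0, hs1, e0, e1⟩ := mem_dartEdge_zero.1 h
    obtain ⟨t, ht0, ht1, f0, f1⟩ := mem_dartEdge_one.1 h'
    apply eq_latticePt <;> norm_num [nodes] <;> linarith
  · obtain ⟨s, hs0, hs1, e0, e1⟩ := mem_dartEdge_one.1 h
    obtain ⟨t, ht0, ht1, f0, f1⟩ := mem_dartEdge_two.1 h'
    apply eq_latticePt <;> norm_num [nodes] <;> linarith
  · obtain ⟨s, hs0, hs1, e0, e1⟩ := mem_dartEdge_two.1 h
    obtain ⟨t, ht0, ht1, f0, f1⟩ := mem_dartEdge_three.1 h'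
    apply eq_latticePt <;> norm_num [nodes] <;> linarith
  · obtain ⟨s, hs0, hs1, e0, e1⟩ := mem_dartEdge_three.1 h
    obtain ⟨t, ht0, ht1, f0, f1⟩ := mem_dartEdge_zero.1 h'
    apply eq_latticePt <;> norm_num [nodes] <;> linarith

lemma dartEdges_through (x : Pt) :
    (∃ i < 4, {i | i < 4 ∧ x ∈ dartEdge i} ⊆ {i, (i + 1) % 4}) := by
  by_cases h0 : x ∈ dartEdge 0 <;> by_cases h1 : x ∈ dartEdge 1
  · refine ⟨0, by norm_num, ?_⟩
    rintro j ⟨hj, hx⟩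
    interval_cases j
    · simp
    · simp
    · exact (dartEdge_zero_two h0 hx).elim
    · exact (dartEdge_one_three h1 hx).elim
  · refine ⟨3, by norm_num, ?_⟩
    rintro j ⟨hj, hx⟩
    interval_cases j
    · simp
    · exact (h1 hx).elim
    · exact (dartEdge_zero_two h0 hx).elim
    · simp
  · refine ⟨1, by norm_num, ?_⟩
    rintro j ⟨hj, hx⟩
    interval_cases j
    · exact (h0 hx).elim
    · simp
    · simp
    · exact (dartEdge_one_three h1 hx).elim
  · refine ⟨2, by norm_num, ?_⟩
    rintro j ⟨hj, hx⟩
    interval_cases j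
    · exact (h0 hx).elim
    · exact (h1 hx).elim
    · simp
    · simp

/-- The nonconvex quadrilateral with vertices `nodes 10`, …, `nodes 13`. -/
def dart : SimplePolygon where
  n := 4
  three_le := by norm_num
  vtx := dartVtx
  periodic i := by simp [dartVtx]
  inj i hi j hj h := by
    have h' := latticePt_injective h
    interval_cases i <;> interval_cases j <;> simp_all [nodes]
  simple x := by
    obtain ⟨i, -, h⟩ := dartEdges_through x
    exact (Set.ncard_le_ncard h (Set.toFinite _)).trans
      ((Set.ncard_insert_le _ _).trans (by simp))
  vtx_of_two x hx := by
    obtain ⟨i, hi, h⟩ := dartEdges_through x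
    have heq := Set.eq_of_subset_of_ncard_le h
      (((Set.ncard_insert_le _ _).trans (by simp)).trans_eq hx.symm) (Set.toFinite _)
    have h₁ : i ∈ {i | i < 4 ∧ x ∈ dartEdge i} := by
      rw [heq]
      simp
    have h₂ : (i + 1) % 4 ∈ {i | i < 4 ∧ x ∈ dartEdge i} := by
      rw [heq]
      simp
    exact ⟨(i + 1) % 4, Nat.mod_lt _ (by norm_num), eq_dartVtx_of_mem hi h₁.2 h₂.2⟩

lemma mem_dart_boundary {x : Pt} : x ∈ dart.boundary ↔ ∃ i < 4, x ∈ dartEdge i := by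
  simp [SimplePolygon.boundary, dart, dartEdge]

/-- The closed region of the quadrilateral: a wedge at the apex, minus a wedge below the
reflex vertex. -/
def dartClosed : Set Pt :=
  {x | 0 ≤ 2419 + 102 * x 0 - 41 * x 1 ∧ 0 ≤ 1711 - 47 * x 0 - 29 * x 1 ∧
    (0 ≤ 41 * x 1 - 43 * x 0 ∨ 0 ≤ 58 * x 1 + 35 * x 0)}

/-- The open region of the quadrilateral. -/
def dartOpen : Set Pt :=
  {x | 0 < 2419 + 102 * x 0 - 41 * x 1 ∧ 0 < 1711 - 47 * x 0 - 29 * x 1 ∧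
    (0 < 41 * x 1 - 43 * x 0 ∨ 0 < 58 * x 1 + 35 * x 0)}

lemma isClosed_dartClosed : IsClosed dartClosed := by
  simp only [dartClosed, Set.ofPred_and, Set.ofPred_or]
  refine .inter ?_ (.inter ?_ (.union ?_ ?_)) <;>
    exact isClosed_le (by fun_prop) (by fun_prop)

lemma isOpen_dartOpen : IsOpen dartOpen := by
  simp only [dartOpen, Set.ofPred_and, Set.ofPred_or]
  refine .inter ?_ (.inter ?_ (.union ?_ ?_)) <;>
    exact isOpen_lt (by fun_prop) (by fun_prop)

lemma dartOpen_subset_dartClosed : dartOpen ⊆ dartClosed :=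
  fun _ h => ⟨h.1.le, h.2.1.le, h.2.2.imp le_of_lt le_of_lt⟩

lemma isBounded_dartOpen : Bornology.IsBounded dartOpen := by
  refine isBounded_iff_forall_norm_le.2 ⟨100, fun x ⟨h₁, h₂, h₃⟩ => ?_⟩
  have h : -60 ≤ x 0 ∧ x 0 ≤ 60 ∧ -60 ≤ x 1 ∧ x 1 ≤ 60 := by
    rcases h₃ with h₃ | h₃ <;> refine ⟨?_, ?_, ?_, ?_⟩ <;> linarith
  rw [EuclideanSpace.norm_eq, Real.sqrt_le_left (by norm_num)]
  simp only [Fin.sum_univ_two, Real.norm_eq_abs, sq_abs]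
  nlinarith

lemma dartOpen_disjoint_boundary {x : Pt} (hx : x ∈ dartOpen) : x ∉ dart.boundary := by
  rw [mem_dart_boundary]
  rintro ⟨i, hi, h⟩
  obtain ⟨h₁, h₂, h₃⟩ := hx
  interval_cases i
  · obtain ⟨t, ht0, ht1, f0, f1⟩ := mem_dartEdge_zero.1 h
    rcases h₃ with h₃ | h₃ <;> linarith
  · obtain ⟨t, ht0, ht1, f0, f1⟩ := mem_dartEdge_one.1 h
    rcases h₃ with h₃ | h₃ <;> linarith
  · obtain ⟨t, ht0, ht1, f0, f1⟩ := mem_dartEdge_two.1 h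
    linarith
  · obtain ⟨t, ht0, ht1, f0, f1⟩ := mem_dartEdge_three.1 h
    linarith

lemma mem_boundary_of_mem_dartClosed {x : Pt} (hx : x ∈ dartClosed) (hx' : x ∉ dartOpen) :
    x ∈ dart.boundary := by
  obtain ⟨h₁, h₂, h₃⟩ := hx
  rw [mem_dart_boundary]
  rcases h₁.eq_or_lt with h₁ | h₁
  · refine ⟨3, by norm_num, mem_dartEdge_three.2 ⟨-x 0 / 41, ?_, ?_, ?_, ?_⟩⟩ <;>
      rcases h₃ with h₃ | h₃ <;> linarith
  rcases h₂.eq_or_lt with h₂ | h₂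
  · refine ⟨2, by norm_num, mem_dartEdge_two.2 ⟨1 - x 0 / 58, ?_, ?_, ?_, ?_⟩⟩ <;>
      rcases h₃ with h₃ | h₃ <;> linarith
  have h₄ : ¬ (0 < 41 * x 1 - 43 * x 0) := fun h => hx' ⟨h₁, h₂, Or.inl h⟩
  have h₅ : ¬ (0 < 58 * x 1 + 35 * x 0) := fun h => hx' ⟨h₁, h₂, Or.inr h⟩
  rcases h₃ with h₃ | h₃
  · refine ⟨0, by norm_num, mem_dartEdge_zero.2 ⟨1 + x 0 / 41, ?_, ?_, ?_, ?_⟩⟩ <;> linarith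
  · refine ⟨1, by norm_num, mem_dartEdge_one.2 ⟨x 0 / 58, ?_, ?_, ?_, ?_⟩⟩ <;> linarith

lemma dartOpen_subset_interior : dartOpen ⊆ dart.interior := by
  intro x hx
  have hxb := dartOpen_disjoint_boundary hx
  refine ⟨hxb, isBounded_dartOpen.subset ?_⟩
  refine isPreconnected_connectedComponentIn.subset_left_of_subset_union isOpen_dartOpen
    isClosed_dartClosed.isOpen_compl ?_ ?_ ⟨x, mem_connectedComponentIn hxb, hx⟩
  · exact Set.disjoint_compl_right_iff_subset.2 dartOpen_subset_dartClosed
  · refine (connectedComponentIn_subset _ _).trans fun y hy => ?_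
    by_contra h
    simp only [Set.mem_union, Set.mem_compl_iff, not_or, not_not] at h
    exact hy (mem_boundary_of_mem_dartClosed h.2 h.1)

lemma dartClosed_subset_region : dartClosed ⊆ dart.region := by
  intro x hx
  by_cases h : x ∈ dartOpen
  · exact Or.inr (dartOpen_subset_interior h)
  · exact Or.inl (mem_boundary_of_mem_dartClosed hx h)

lemma axis_nonneg_of_mem_boundary {x : Pt} (hx : x ∈ dart.boundary) (h0 : x 0 = 0) :
    0 ≤ x 1 := by
  obtain ⟨i, hi, h⟩ := mem_dart_boundary.1 hx
  interval_cases i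
  · obtain ⟨t, ht0, ht1, f0, f1⟩ := mem_dartEdge_zero.1 h
    linarith
  · obtain ⟨t, ht0, ht1, f0, f1⟩ := mem_dartEdge_one.1 h
    linarith
  · obtain ⟨t, ht0, ht1, f0, f1⟩ := mem_dartEdge_two.1 h
    linarith
  · obtain ⟨t, ht0, ht1, f0, f1⟩ := mem_dartEdge_three.1 h
    linarith

lemma axis_nonneg_of_mem_region {x : Pt} (hx : x ∈ dart.region) (h0 : x 0 = 0) :
    0 ≤ x 1 := by
  by_contra! hneg
  rcases hx with hx | ⟨hxb, hbdd⟩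
  · exact absurd (axis_nonneg_of_mem_boundary hx h0) (not_le.2 hneg)
  have hray : (fun s : ℝ => (!₂[0, s] : Pt)) '' Set.Iic (x 1) ⊆
      connectedComponentIn dart.boundaryᶜ x := by
    refine IsPreconnected.subset_connectedComponentIn ?_ ?_ ?_
    · exact isPreconnected_Iic.image _ (by fun_prop)
    · refine ⟨x 1, Set.mem_Iic.2 le_rfl, ?_⟩
      ext i
      fin_cases i
      · simp [h0]
      · simp
    · rintro _ ⟨s, hs, rfl⟩ hb
      have := axis_nonneg_of_mem_boundary hb (by simp)
      simp only [Matrix.cons_val_one, Matrix.cons_val_fin_one] at this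
      exact absurd (this.trans hs) (not_le.2 hneg)
  obtain ⟨R, hR⟩ := isBounded_iff_forall_norm_le.1 (hbdd.subset hray)
  have h₁ := hR _ ⟨min (x 1) (-(|R| + 1)), Set.mem_Iic.2 (min_le_left _ _), rfl⟩
  have h₂ := (PiLp.norm_apply_le (!₂[0, min (x 1) (-(|R| + 1))] : Pt) 1).trans h₁
  simp only [Matrix.cons_val_one, Matrix.cons_val_fin_one,
    Real.norm_eq_abs] at h₂
  have h₃ := min_le_right (x 1) (-(|R| + 1))
  have h₄ := neg_abs_le (min (x 1) (-(|R| + 1)))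
  have h₅ := le_abs_self R
  linarith

/-- Twice the signed area of the triangle `nodes 10`, `nodes 11`, `a`. -/
def leftSide (a : ℤ × ℤ) : ℤ := 41 * a.2 - 43 * a.1

/-- Twice the signed area of the triangle `nodes 11`, `nodes 12`, `a`. -/
def rightSide (a : ℤ × ℤ) : ℤ := 58 * a.2 + 35 * a.1

/-- The lattice point `a` lies in the closed quadrilateral. -/
abbrev InsideClosed (a : ℤ × ℤ) : Prop :=
  0 ≤ 2419 + 102 * a.1 - 41 * a.2 ∧ 0 ≤ 1711 - 47 * a.1 - 29 * a.2 ∧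
    (0 ≤ leftSide a ∨ 0 ≤ rightSide a)

/-- The lattice point `a` lies in the open quadrilateral. -/
abbrev InsideOpen (a : ℤ × ℤ) : Prop :=
  0 < 2419 + 102 * a.1 - 41 * a.2 ∧ 0 < 1711 - 47 * a.1 - 29 * a.2 ∧
    (0 < leftSide a ∨ 0 < rightSide a)

/-- A sufficient condition for two lattice points of the quadrilateral to see each other. -/
abbrev Sees (a b : ℤ × ℤ) : Prop :=
  (0 ≤ leftSide a ∧ 0 ≤ leftSide b) ∨ (0 ≤ rightSide a ∧ 0 ≤ rightSide b) ∨
    (0 ≤ leftSide a ∧ 0 ≤ rightSide b ∧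
      leftSide b * rightSide a ≤ leftSide a * rightSide b) ∨
    (0 ≤ leftSide b ∧ 0 ≤ rightSide a ∧
      leftSide a * rightSide b ≤ leftSide b * rightSide a)

/-- The segment between the lattice points `a` and `b` meets the vertical axis below the origin. -/
abbrev Hidden (a b : ℤ × ℤ) : Prop :=
  a.1 * b.1 < 0 ∧ (b.1 * a.2 - a.1 * b.2) * (b.1 - a.1) < 0

lemma latticePt_mem_dartClosed {a : ℤ × ℤ} (h : InsideClosed a) : latticePt a ∈ dartClosed := by
  obtain ⟨h₁, h₂, h₃⟩ := h
  refine ⟨?_, ?_, h₃.imp (fun h₃ => ?_) (fun h₃ => ?_)⟩ <;>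
    simp only [latticePt_zero, latticePt_one, leftSide, rightSide] at * <;>
    exact_mod_cast by assumption

lemma latticePt_mem_dartOpen {a : ℤ × ℤ} (h : InsideOpen a) : latticePt a ∈ dartOpen := by
  obtain ⟨h₁, h₂, h₃⟩ := h
  refine ⟨?_, ?_, h₃.imp (fun h₃ => ?_) (fun h₃ => ?_)⟩ <;>
    simp only [latticePt_zero, latticePt_one, leftSide, rightSide] at * <;>
    exact_mod_cast by assumption

/-- A convex combination of two values of each of two functionals cannot be negative for both. -/
lemma convexComb_nonneg_or {s t u v u' v' : ℝ} (hs : 0 ≤ s) (ht : 0 ≤ t) (hu : 0 ≤ u)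
    (hv : 0 ≤ v') (h : u' * v ≤ u * v') :
    0 ≤ s * u + t * u' ∨ 0 ≤ s * v + t * v' := by
  by_contra! hneg
  obtain ⟨h₁, h₂⟩ := hneg
  have hu' : u' < 0 := by
    by_contra! hh
    nlinarith [mul_nonneg hs hu, mul_nonneg ht hh]
  have hv' : v < 0 := by
    by_contra! hh
    nlinarith [mul_nonneg hs hh, mul_nonneg ht hv]
  have hs' : 0 < s := by
    rcases hs.eq_or_lt with rfl | hs
    · nlinarith [mul_nonneg ht hv]
    · exact hs
  nlinarith [mul_nonneg ht hv, mul_nonneg hs hu]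

lemma segment_subset_dart_region {a b : ℤ × ℤ} (ha : InsideClosed a) (hb : InsideClosed b)
    (h : Sees a b) : segment ℝ (latticePt a) (latticePt b) ⊆ dart.region := by
  refine Set.Subset.trans ?_ dartClosed_subset_region
  obtain ⟨a₁, a₂, -⟩ := latticePt_mem_dartClosed ha
  obtain ⟨b₁, b₂, -⟩ := latticePt_mem_dartClosed hb
  rintro _ ⟨s, t, hs, ht, hst, rfl⟩
  have key : 0 ≤ s * (leftSide a : ℝ) + t * (leftSide b : ℝ) ∨
      0 ≤ s * (rightSide a : ℝ) + t * (rightSide b : ℝ) := by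
    rcases h with ⟨h₁, h₂⟩ | ⟨h₁, h₂⟩ | ⟨h₁, h₂, h₃⟩ | ⟨h₁, h₂, h₃⟩
    · left
      have : (0 : ℝ) ≤ leftSide a := by exact_mod_cast h₁
      have : (0 : ℝ) ≤ leftSide b := by exact_mod_cast h₂
      positivity
    · right
      have : (0 : ℝ) ≤ rightSide a := by exact_mod_cast h₁
      have : (0 : ℝ) ≤ rightSide b := by exact_mod_cast h₂
      positivity
    · exact convexComb_nonneg_or hs ht (by exact_mod_cast h₁) (by exact_mod_cast h₂)
        (by exact_mod_cast h₃)
    · rw [add_comm, add_comm (s * (rightSide a : ℝ))]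
      exact convexComb_nonneg_or ht hs (by exact_mod_cast h₁) (by exact_mod_cast h₂)
        (by exact_mod_cast h₃)
  simp only [latticePt_zero, latticePt_one] at a₁ a₂ b₁ b₂
  simp only [leftSide, rightSide, Int.cast_sub, Int.cast_add, Int.cast_mul, Int.cast_ofNat] at key
  refine ⟨?_, ?_, ?_⟩
  · simp only [PiLp.add_apply, PiLp.smul_apply, smul_eq_mul, latticePt_zero, latticePt_one]
    obtain rfl : t = 1 - s := by linarith
    nlinarith [mul_nonneg hs a₁, mul_nonneg ht b₁]
  · simp only [PiLp.add_apply, PiLp.smul_apply, smul_eq_mul, latticePt_zero, latticePt_one]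
    obtain rfl : t = 1 - s := by linarith
    nlinarith [mul_nonneg hs a₂, mul_nonneg ht b₂]
  · simp only [PiLp.add_apply, PiLp.smul_apply, smul_eq_mul, latticePt_zero, latticePt_one]
    refine key.imp (fun h => h.trans_eq ?_) (fun h => h.trans_eq ?_) <;> ring

lemma Hidden.passesBelow {a b : ℤ × ℤ} (h : Hidden a b) :
    PassesBelow (latticePt (0, 0)) (latticePt a) (latticePt b) := by
  obtain ⟨h₁, h₂⟩ := h
  have h₁' : (a.1 * b.1 : ℝ) < 0 := by exact_mod_cast h₁
  have h₂' : ((b.1 * a.2 - a.1 * b.2) * (b.1 - a.1) : ℝ) < 0 := by exact_mod_cast h₂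
  refine ⟨h₁', ?_⟩
  obtain ⟨x, hx, hx0⟩ :=
    exists_mem_segment_coord_eq_zero (a := latticePt a) (b := latticePt b) h₁'.le
  refine ⟨x, hx, hx0, ?_⟩
  obtain ⟨t, ht0, ht1, e0, e1⟩ := mem_segment_latticePt.1 hx
  rw [hx0] at e0
  simp only [latticePt_one, Int.cast_zero]
  have e : x 1 * ((b.1 : ℝ) - a.1) ^ 2 = (b.1 * a.2 - a.1 * b.2) * (b.1 - a.1) := by
    have : t * ((b.1 : ℝ) - a.1) = -a.1 := by linarith
    rw [e1]
    linear_combination ((b.2 : ℝ) - a.2) * (b.1 - a.1) * this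
  by_contra! hneg
  nlinarith [mul_nonneg hneg (sq_nonneg ((b.1 : ℝ) - a.1))]

lemma nodes_insideOpen : ∀ i < 10, 1 ≤ i → InsideOpen (nodes i) := by decide

lemma nodes_insideClosed : ∀ i < 12, 1 ≤ i → i ≠ 10 → InsideClosed (nodes i) := by decide

lemma nodes_sees_apex : ∀ i < 10, 1 ≤ i → Sees (nodes i) (0, 0) := by decide

set_option synthInstance.maxSize 4000 in
set_option synthInstance.maxHeartbeats 200000 in
lemma nodes_sees_or_hidden : ∀ i < 10, 1 ≤ i → ∀ j < 10, 1 ≤ j →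
    i = j ∨ Sees (nodes i) (nodes j) ∨ Hidden (nodes i) (nodes j) := by decide

set_option synthInstance.maxSize 4000 in
set_option synthInstance.maxHeartbeats 200000 in
lemma nodes_slopes_distinct : ∀ i < 14, 1 ≤ i → ∀ j < i, 1 ≤ j → ∀ k < 14, 1 ≤ k →
    ∀ l < k, 1 ≤ l → detZ (nodes i) (nodes j) (nodes k) (nodes l) = 0 → i = k ∧ j = l := by
  decide +kernel

lemma detZ_swap_left (a b c d : ℤ × ℤ) : detZ b a c d = -detZ a b c d := by
  simp only [detZ]
  ring

lemma detZ_swap_right (a b c d : ℤ × ℤ) : detZ a b d c = -detZ a b c d := by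
  simp only [detZ]
  ring

lemma nodes_detZ_ne_zero {i j k l : ℕ} (hi : 1 ≤ i ∧ i < 14) (hj : 1 ≤ j ∧ j < 14)
    (hk : 1 ≤ k ∧ k < 14) (hl : 1 ≤ l ∧ l < 14) (hij : i ≠ j) (hkl : k ≠ l)
    (h₁ : ¬ (i = k ∧ j = l)) (h₂ : ¬ (i = l ∧ j = k)) :
    detZ (nodes i) (nodes j) (nodes k) (nodes l) ≠ 0 := by
  intro h
  rcases hij.lt_or_gt with hij | hij <;> rcases hkl.lt_or_gt with hkl | hkl
  · have := nodes_slopes_distinct j hj.2 hj.1 i hij hi.1 l hl.2 hl.1 k hkl hk.1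
      (by rw [detZ_swap_left, detZ_swap_right, h]; rfl)
    exact h₁ this.symm
  · have := nodes_slopes_distinct j hj.2 hj.1 i hij hi.1 k hk.2 hk.1 l hkl hl.1
      (by rw [detZ_swap_left, h]; rfl)
    exact h₂ this.symm
  · have := nodes_slopes_distinct i hi.2 hi.1 j hij hj.1 l hl.2 hl.1 k hkl hk.1
      (by rw [detZ_swap_right, h]; rfl)
    exact h₂ this
  · exact h₁ (nodes_slopes_distinct i hi.2 hi.1 j hij hj.1 k hk.2 hk.1 l hkl hl.1 h)

lemma strongGenPos_nodes : StrongGenPos {x | ∃ i, (1 ≤ i ∧ i < 14) ∧ x = latticePt (nodes i)} := by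
  constructor
  · rintro _ ⟨i, hi, rfl⟩ _ ⟨j, hj, rfl⟩ _ ⟨k, hk, rfl⟩ hij hik hjk
    rw [det2_latticePt, Int.cast_ne_zero]
    have hij : i ≠ j := fun h => hij (by rw [h])
    have hik : i ≠ k := fun h => hik (by rw [h])
    have hjk : j ≠ k := fun h => hjk (by rw [h])
    exact nodes_detZ_ne_zero hi hj hi hk hij hik (by tauto) (by tauto)
  · rintro _ ⟨i, hi, rfl⟩ _ ⟨j, hj, rfl⟩ _ ⟨k, hk, rfl⟩ _ ⟨l, hl, rfl⟩ hij hik hil - - hkl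
    rw [det2_latticePt, Int.cast_ne_zero]
    have hij : i ≠ j := fun h => hij (by rw [h])
    have hik : i ≠ k := fun h => hik (by rw [h])
    have hil : i ≠ l := fun h => hil (by rw [h])
    have hkl : k ≠ l := fun h => hkl (by rw [h])
    exact nodes_detZ_ne_zero hi hj hk hl hij hkl (by tauto) (by tauto)

lemma StrongGenPos.mono {S T : Set Pt} (h : StrongGenPos T) (hST : S ⊆ T) : StrongGenPos S :=
  ⟨fun p hp q hq r hr => h.1 p (hST hp) q (hST hq) r (hST hr),
    fun p hp q hq r hr s hs => h.2 p (hST hp) q (hST hq) r (hST hr) s (hST hs)⟩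

lemma nodes_injOn {i j : ℕ} (hi : 1 ≤ i ∧ i < 14) (hj : 1 ≤ j ∧ j < 14)
    (h : nodes i = nodes j) : i = j := by
  by_contra hij
  obtain ⟨k, hk, hki, hkj⟩ : ∃ k, (1 ≤ k ∧ k < 14) ∧ i ≠ k ∧ j ≠ k := by
    by_cases h1 : i ≠ 1 ∧ j ≠ 1
    · exact ⟨1, by norm_num, h1.1, h1.2⟩
    · by_cases h2 : i ≠ 2 ∧ j ≠ 2
      · exact ⟨2, by norm_num, h2.1, h2.2⟩
      · exact ⟨3, by norm_num, by omega, by omega⟩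
  refine nodes_detZ_ne_zero hi hj hi hk hij hki (by tauto) (by tauto) ?_
  rw [h]
  simp [detZ]

/-- The geodesic between two of the nine points. -/
def dartChain (i j : ℕ) : List Pt :=
  if Sees (nodes i) (nodes j) then [latticePt (nodes i), latticePt (nodes j)]
  else [latticePt (nodes i), latticePt (0, 0), latticePt (nodes j)]

lemma dart_isGeodesicChain_iff {i j : ℕ} (hi : 1 ≤ i ∧ i < 10) (hj : 1 ≤ j ∧ j < 10)
    (hij : i ≠ j) (L : List Pt) :
    dart.IsGeodesicChain (latticePt (nodes i)) (latticePt (nodes j)) L ↔ L = dartChain i j := by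
  have ci := nodes_insideClosed i (by omega) hi.1 (by omega)
  have cj := nodes_insideClosed j (by omega) hj.1 (by omega)
  have cw : InsideClosed (0, 0) := nodes_insideClosed 11 (by norm_num) (by norm_num) (by norm_num)
  have hne : latticePt (nodes i) ≠ latticePt (nodes j) := fun h =>
    hij (nodes_injOn ⟨hi.1, by omega⟩ ⟨hj.1, by omega⟩ (latticePt_injective h))
  rw [dartChain]
  split_ifs with h
  · exact dart.isGeodesicChain_iff_of_segment_subset hne (segment_subset_dart_region ci cj h) L
  · have hh : Hidden (nodes i) (nodes j) :=
      ((nodes_sees_or_hidden i hi.2 hi.1 j hj.2 hj.1).resolve_left hij).resolve_left h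
    refine dart.isGeodesicChain_iff_of_passesBelow (by simp) ?_ hh.passesBelow
      (segment_subset_dart_region ci cw (nodes_sees_apex i hi.2 hi.1)) ?_ ?_ L
    · intro x hx hx0
      simpa using axis_nonneg_of_mem_region hx hx0
    · rw [segment_symm]
      exact segment_subset_dart_region cj cw (nodes_sees_apex j hj.2 hj.1)
    · rw [det2_latticePt, Int.cast_ne_zero]
      exact nodes_detZ_ne_zero (j := 11) ⟨hi.1, by omega⟩ (by norm_num) ⟨hi.1, by omega⟩
        ⟨hj.1, by omega⟩ (by omega) hij (by omega) (by omega)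

/-- The integer determinant whose sign is the geodesic orientation of three of the points. -/
def geodDet (i j k : ℕ) : ℤ :=
  if Sees (nodes i) (nodes j) then
    if Sees (nodes i) (nodes k) then detZ (nodes i) (nodes j) (nodes i) (nodes k)
    else detZ (nodes i) (nodes j) (nodes i) (0, 0)
  else
    if Sees (nodes i) (nodes k) then detZ (nodes i) (0, 0) (nodes i) (nodes k)
    else detZ (0, 0) (nodes j) (0, 0) (nodes k)

lemma dart_geodesicCCW_iff {i j k : ℕ} (hi : 1 ≤ i ∧ i < 10) (hj : 1 ≤ j ∧ j < 10)
    (hk : 1 ≤ k ∧ k < 10) (hij : i ≠ j) (hik : i ≠ k) (hjk : j ≠ k) :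
    geodesicCCW dart (latticePt (nodes i)) (latticePt (nodes j)) (latticePt (nodes k)) ↔
      0 < geodDet i j k := by
  have hL := dart_isGeodesicChain_iff hi hj hij
  have hM := dart_isGeodesicChain_iff hi hk hik
  have hne {a b : ℕ} (ha : 1 ≤ a ∧ a < 14) (hb : 1 ≤ b ∧ b < 14) (hab : a ≠ b) :
      latticePt (nodes a) ≠ latticePt (nodes b) := fun h =>
    hab (nodes_injOn ha hb (latticePt_injective h))
  have hj' : 1 ≤ j ∧ j < 14 := ⟨hj.1, by omega⟩
  have hk' : 1 ≤ k ∧ k < 14 := ⟨hk.1, by omega⟩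
  have hw : 1 ≤ 11 ∧ 11 < 14 := by norm_num
  have hpre {L M : List Pt} {a : Pt} : ∀ n < 1, (a :: L)[n]? = (a :: M)[n]? := by
    intro n hn
    obtain rfl : n = 0 := by omega
    rfl
  rw [dartChain] at hL hM
  rw [geodDet]
  split_ifs at hL hM ⊢
  · rw [geodesicCCW_iff hL hM one_pos hpre rfl rfl rfl (hne hj' hk' hjk), det2_latticePt,
      Int.cast_pos]
  · rw [geodesicCCW_iff hL hM one_pos hpre rfl rfl rfl (hne hj' hw (by omega)), det2_latticePt,
      Int.cast_pos]
  · rw [geodesicCCW_iff hL hM one_pos hpre rfl rfl rfl (hne hw hk' (by omega)), det2_latticePt,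
      Int.cast_pos]
  · refine (geodesicCCW_iff hL hM two_pos ?_ rfl rfl rfl (hne hj' hk' hjk)).trans ?_
    · intro n hn
      interval_cases n <;> rfl
    · rw [det2_latticePt, Int.cast_pos]

/-- The counterclockwise triples, as a list. -/
def ccwTriples : List (ℕ × ℕ × ℕ) :=
  [(2,7,8),(2,7,9),(3,4,5),(3,4,8),(3,6,8),(3,7,8),(3,7,9),(4,6,7),(4,6,8),(4,6,9),
   (4,7,8),(4,7,9),(5,6,7),(5,6,8),(5,6,9),(5,7,8),(5,7,9),(5,8,9),(6,7,8),(6,7,9)]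

lemma mem_nonPappusCCW_iff (t : ℕ × ℕ × ℕ) : t ∈ nonPappusCCW ↔ t ∈ ccwTriples := by
  simp [nonPappusCCW, ccwTriples]

set_option synthInstance.maxSize 1000 in
set_option synthInstance.maxHeartbeats 200000 in
lemma geodDet_pos_iff : ∀ k < 10, ∀ j < k, ∀ i < j, 1 ≤ i →
    (0 < geodDet i j k ↔ (i, j, k) ∈ ccwTriples) := by
  decide +kernel

/-- The non-Pappus abstract order type is realizable as a geodesic order
type: nine points inside a suitable simple polygon. -/
theorem nonPappus_geodesically_realizable :
    ∃ (p : ℕ → Pt) (P : SimplePolygon),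
      (∀ i, 1 ≤ i → i ≤ 9 → ∀ j, 1 ≤ j → j ≤ 9 → p i = p j → i = j) ∧
      (∀ i, 1 ≤ i → i ≤ 9 → p i ∈ P.interior) ∧
      StrongGenPos ({x | ∃ i, 1 ≤ i ∧ i ≤ 9 ∧ x = p i} ∪ P.vertexSet) ∧
      ∀ i j k : ℕ, 1 ≤ i → i < j → j < k → k ≤ 9 →
        (geodesicCCW P (p i) (p j) (p k) ↔ (i, j, k) ∈ nonPappusCCW) := by
  refine ⟨fun i => latticePt (nodes i), dart, ?_, ?_, strongGenPos_nodes.mono ?_, ?_⟩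
  · intro i hi hi' j hj hj' h
    exact nodes_injOn ⟨hi, by omega⟩ ⟨hj, by omega⟩ (latticePt_injective h)
  · intro i hi hi'
    exact dartOpen_subset_interior (latticePt_mem_dartOpen (nodes_insideOpen i (by omega) hi))
  · rintro x (⟨i, hi, hi', rfl⟩ | ⟨i, hi, rfl⟩)
    · exact ⟨i, ⟨hi, by omega⟩, rfl⟩
    · exact ⟨10 + i % 4, by omega, rfl⟩
  · intro i j k hi hij hjk hk
    rw [mem_nonPappusCCW_iff, ← geodDet_pos_iff k (by omega) j hjk i hij hi]
    exact dart_geodesicCCW_iff ⟨hi, by omega⟩ ⟨by omega, by omega⟩ ⟨by omega, by omega⟩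
      (by omega) (by omega) (by omega)
end
end

section
/- Let S be a set of five points in the plane with no three collinear. Then there exist four points a, b, c, d ∈ S in convex position such that the remaining fifth point e ∈ S does not lie in the convex hull of {a, b, c, d}. -/
open scoped RealInnerProductSpace ENNReal Classical

noncomputable section

/-- Four points are in convex position: each lies outside the convex hull of the other
three. -/
def ConvexPos4 (a b c d : Pt) : Prop :=
  a ∉ convexHull ℝ ({b, c, d} : Set Pt) ∧ b ∉ convexHull ℝ ({a, c, d} : Set Pt) ∧
  c ∉ convexHull ℝ ({a, b, d} : Set Pt) ∧ d ∉ convexHull ℝ ({a, b, c} : Set Pt)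

/-- The orientation of the triple `(a, b, c)`, positive when it is counterclockwise. -/
def orient (a b c : Pt) : ℝ := det2 (b - a) (c - a)

lemma orient_rotate (a b c : Pt) : orient b c a = orient a b c := by
  simp only [orient, det2, PiLp.sub_apply]
  ring

lemma orient_swap (a b c : Pt) : orient b a c = -orient a b c := by
  simp only [orient, det2, PiLp.sub_apply]
  ring

lemma orient_self_left (a b : Pt) : orient a b a = 0 := by
  simp [orient, det2]

lemma orient_self_right (a b : Pt) : orient a b b = 0 := by
  rw [← orient_rotate, ← orient_rotate, orient, det2]
  simp

lemma convex_setOf_orient_nonneg (a b : Pt) : Convex ℝ {x | 0 ≤ orient a b x} := by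
  intro x hx y hy s t hs ht hst
  have h : orient a b (s • x + t • y) = s * orient a b x + t * orient a b y := by
    obtain rfl : t = 1 - s := by linarith
    simp only [orient, det2, PiLp.sub_apply, PiLp.add_apply, PiLp.smul_apply, smul_eq_mul]
    ring
  simp only [Set.mem_ofPred_eq] at hx hy ⊢
  rw [h]
  positivity

/-- A directed line having `s` weakly on its left and `x` strictly on its right
separates `x` from the convex hull of `s`. -/
lemma notMem_convexHull_of_orient_neg {s : Set Pt} {a b x : Pt}
    (hs : ∀ y ∈ s, 0 ≤ orient a b y) (hx : orient a b x < 0) : x ∉ convexHull ℝ s :=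
  fun h => hx.not_ge (convexHull_min hs (convex_setOf_orient_nonneg a b) h)

lemma notMem_convexHull_triple {a b c d : Pt} (hbcd : 0 < orient b c d)
    (hdab : 0 < orient d a b) : a ∉ convexHull ℝ ({b, c, d} : Set Pt) := by
  refine notMem_convexHull_of_orient_neg (a := d) (b := b) ?_ ?_
  · rintro y (rfl | rfl | rfl)
    · exact (orient_self_right _ _).ge
    · rw [← orient_rotate]
      exact hbcd.le
    · exact (orient_self_left _ _).ge
  · linarith [orient_swap b d a, orient_rotate b d a]

lemma convexPos4_of_orient_pos {a b c d : Pt} (habc : 0 < orient a b c)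
    (hbcd : 0 < orient b c d) (hcda : 0 < orient c d a) (hdab : 0 < orient d a b) :
    ConvexPos4 a b c d := by
  refine ⟨notMem_convexHull_triple hbcd hdab, ?_, ?_, notMem_convexHull_triple habc hcda⟩
  · convert notMem_convexHull_triple hcda habc using 3
    aesop
  · convert notMem_convexHull_triple hdab hbcd using 3
    aesop

lemma notMem_convexHull_quadrilateral {a b c d e : Pt} (habc : 0 < orient a b c)
    (hdab : 0 < orient d a b) (he : orient a b e < 0) :
    e ∉ convexHull ℝ ({a, b, c, d} : Set Pt) := by
  refine notMem_convexHull_of_orient_neg ?_ he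
  rintro y (rfl | rfl | rfl | rfl)
  · exact (orient_self_left _ _).ge
  · exact (orient_self_right _ _).ge
  · exact habc.le
  · rw [orient_rotate]
    exact hdab.le

/-- Five points, the last four of which are sorted by angle around the first, contain an
empty convex quadrilateral. -/
lemma exists_empty_quadrilateral_of_sorted {S : Set Pt} {o p q r s : Pt}
    (hS : S = {o, p, q, r, s}) (hcol : NoThreeCollinear S) (hd : [o, p, q, r, s].Nodup)
    (hpq : 0 < orient o p q) (hpr : 0 < orient o p r) (hps : 0 < orient o p s)
    (hqr : 0 < orient o q r) (hqs : 0 < orient o q s) (hrs : 0 < orient o r s) :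
    ∃ a b c d e : Pt, S = {a, b, c, d, e} ∧ [a, b, c, d, e].Nodup ∧
      ConvexPos4 a b c d ∧ e ∉ convexHull ℝ ({a, b, c, d} : Set Pt) := by
  have key : ∀ a b c d e : Pt, [o, p, q, r, s].Perm [a, b, c, d, e] →
      0 < orient a b c → 0 < orient b c d → 0 < orient c d a → 0 < orient d a b →
      orient a b e < 0 →
      ∃ a b c d e : Pt, S = {a, b, c, d, e} ∧ [a, b, c, d, e].Nodup ∧
        ConvexPos4 a b c d ∧ e ∉ convexHull ℝ ({a, b, c, d} : Set Pt) := by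
    intro a b c d e hperm h₁ h₂ h₃ h₄ he
    refine ⟨a, b, c, d, e, ?_, hperm.nodup_iff.1 hd, convexPos4_of_orient_pos h₁ h₂ h₃ h₄,
      notMem_convexHull_quadrilateral h₁ h₄ he⟩
    ext x
    simpa [hS] using hperm.mem_iff (a := x)
  have hne : ∀ x ∈ S, ∀ y ∈ S, ∀ z ∈ S, x ≠ y → x ≠ z → y ≠ z →
      orient x y z < 0 ∨ 0 < orient x y z :=
    fun x hx y hy z hz hxy hxz hyz => lt_or_gt_of_ne (hcol x hx y hy z hz hxy hxz hyz)
  have hp : p ∈ S := by simp [hS]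
  have hq : q ∈ S := by simp [hS]
  have hr : r ∈ S := by simp [hS]
  have hs : s ∈ S := by simp [hS]
  have hrot := orient_rotate
  have hswap := orient_swap
  simp only [List.nodup_cons, List.mem_cons, List.not_mem_nil, or_false, not_or] at hd
  obtain ⟨-, ⟨npq, npr, nps⟩, ⟨nqr, nqs⟩, nrs, -⟩ := hd
  rcases hne p hp q hq r hr npq npr nqr with pqr | pqr
  swap
  · refine key r o p q s (List.perm_iff_count.2 fun x => by simp only [List.count_cons]; ring)
      ?_ ?_ ?_ ?_ ?_ <;> clear key hne <;> grind
  rcases hne q hq r hr s hs nqr nqs nrs with qrs | qrs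
  swap
  · refine key o q r s p (List.perm_iff_count.2 fun x => by simp only [List.count_cons]; ring)
      ?_ ?_ ?_ ?_ ?_ <;> clear key hne <;> grind
  rcases hne p hp q hq s hs npq nps nqs with pqs | pqs
  swap
  · refine key p q s o r (List.perm_iff_count.2 fun x => by simp only [List.count_cons]; ring)
      ?_ ?_ ?_ ?_ ?_ <;> clear key hne <;> grind
  rcases hne p hp r hr s hs npr nps nrs with prs | prs
  swap
  · refine key r s o p q (List.perm_iff_count.2 fun x => by simp only [List.count_cons]; ring)
      ?_ ?_ ?_ ?_ ?_ <;> clear key hne <;> grind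
  · refine key q p s r o (List.perm_iff_count.2 fun x => by simp only [List.count_cons]; ring)
      ?_ ?_ ?_ ?_ ?_ <;> clear key hne <;> grind

/-- On the lexicographically positive vectors, having positive determinant is a
transitive relation. -/
lemma det2_pos_trans {u v w : Pt} (hu : 0 < u 0 ∨ u 0 = 0 ∧ 0 < u 1)
    (hv : 0 < v 0 ∨ v 0 = 0 ∧ 0 < v 1) (hw : 0 < w 0 ∨ w 0 = 0 ∧ 0 < w 1)
    (huv : 0 < det2 u v) (hvw : 0 < det2 v w) : 0 < det2 u w := by
  have key : v 0 * det2 u w = u 0 * det2 v w + w 0 * det2 u v := by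
    simp only [det2]
    ring
  have hu0 : 0 ≤ u 0 := hu.elim le_of_lt fun h => h.1.ge
  have hw0 : 0 ≤ w 0 := hw.elim le_of_lt fun h => h.1.ge
  rcases hv with hv | ⟨hv, hv'⟩
  · refine pos_of_mul_pos_right (a := v 0) ?_ hv.le
    rw [key]
    rcases hu with hu | ⟨hu, hu'⟩
    · positivity
    · simp only [det2, hu] at huv
      nlinarith
  · simp only [det2, hv] at hvw
    nlinarith

/-- A nonempty finite set has a least element for a relation that is transitive and total
on it. -/
lemma exists_least_of_trans_of_total {α : Type*} {r : α → α → Prop} {T : Finset α}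
    (hT : T.Nonempty) (htrans : ∀ x ∈ T, ∀ y ∈ T, ∀ z ∈ T, r x y → r y z → r x z)
    (htotal : ∀ x ∈ T, ∀ y ∈ T, x ≠ y → r x y ∨ r y x) :
    ∃ m ∈ T, ∀ x ∈ T, x ≠ m → r m x := by
  induction hT using Finset.Nonempty.cons_induction with
  | singleton a => simp
  | cons a T ha hT ih =>
    obtain ⟨m, hm, hmin⟩ := ih
      (fun x hx y hy z hz => htrans x (by simp [hx]) y (by simp [hy]) z (by simp [hz]))
      (fun x hx y hy => htotal x (by simp [hx]) y (by simp [hy]))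
    simp only [Finset.mem_cons] at *
    rcases htotal a (.inl rfl) m (.inr hm) (by grind) with h | h
    · exact ⟨a, .inl rfl, by grind⟩
    · exact ⟨m, .inr hm, by grind⟩

/-- A finite set has a point from which all the other ones lie in lexicographically positive
direction. -/
lemma exists_lex_min {S : Finset Pt} (hS : S.Nonempty) :
    ∃ o ∈ S, ∀ x ∈ S, x ≠ o → 0 < (x - o) 0 ∨ (x - o) 0 = 0 ∧ 0 < (x - o) 1 := by
  obtain ⟨o, ho, hmin⟩ := S.exists_min_image (fun p => toLex (p 0, p 1)) hS
  refine ⟨o, ho, fun x hx hne => ?_⟩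
  have h := hmin x hx
  simp only [Prod.Lex.toLex_le_toLex] at h
  simp only [PiLp.sub_apply]
  rcases h with h | ⟨h0, h1⟩
  · exact .inl (sub_pos.2 h)
  · refine .inr ⟨sub_eq_zero.2 h0.symm, sub_pos.2 (lt_of_le_of_ne h1 fun h1 => hne ?_)⟩
    ext i
    fin_cases i
    · exact h0.symm
    · exact h1.symm

/-- Any five points with no three collinear contain four points in convex
position whose convex hull avoids the fifth point. -/
theorem five_points_contain_empty_convex_quadrilateral
    (S : Finset Pt) (hcard : S.card = 5) (hcol : NoThreeCollinear (↑S : Set Pt)) :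
    ∃ a b c d e : Pt, (↑S : Set Pt) = {a, b, c, d, e} ∧ [a, b, c, d, e].Nodup ∧
      ConvexPos4 a b c d ∧ e ∉ convexHull ℝ ({a, b, c, d} : Set Pt) := by
  obtain ⟨o, ho, hpos⟩ := exists_lex_min (S := S) (Finset.card_pos.1 (by omega))
  have htrans : ∀ x ∈ S.erase o, ∀ y ∈ S.erase o, ∀ z ∈ S.erase o,
      0 < orient o x y → 0 < orient o y z → 0 < orient o x z := by
    intro x hx y hy z hz
    rw [Finset.mem_erase] at hx hy hz
    exact det2_pos_trans (hpos x hx.2 hx.1) (hpos y hy.2 hy.1) (hpos z hz.2 hz.1)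
  have htotal : ∀ x ∈ S.erase o, ∀ y ∈ S.erase o, x ≠ y →
      0 < orient o x y ∨ 0 < orient o y x := by
    intro x hx y hy hxy
    rw [Finset.mem_erase] at hx hy
    have h : orient o x y ≠ 0 := hcol o ho x hx.2 y hy.2 hx.1.symm hy.1.symm hxy
    have hswap : orient o y x = -orient o x y := by
      rw [← orient_swap, orient_rotate]
    rw [hswap, neg_pos]
    exact h.gt_or_lt
  have least : ∀ T ⊆ S.erase o, 0 < T.card →
      ∃ m ∈ T, (T.erase m).card + 1 = T.card ∧ ∀ x ∈ T.erase m, 0 < orient o m x := by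
    intro T hT hcard
    obtain ⟨m, hm, hmin⟩ := exists_least_of_trans_of_total (Finset.card_pos.1 hcard)
      (fun x hx y hy z hz => htrans x (hT hx) y (hT hy) z (hT hz))
      (fun x hx y hy => htotal x (hT hx) y (hT hy))
    exact ⟨m, hm, Finset.card_erase_add_one hm, fun x hx =>
      hmin x (Finset.mem_of_mem_erase hx) (Finset.ne_of_mem_erase hx)⟩
  have hcard' := Finset.card_erase_add_one ho
  obtain ⟨p, hp, cp, hp'⟩ := least (S.erase o) subset_rfl (by omega)
  obtain ⟨q, hq, cq, hq'⟩ := least ((S.erase o).erase p) (by grind) (by omega)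
  obtain ⟨r, hr, cr, hr'⟩ := least (((S.erase o).erase p).erase q) (by grind) (by omega)
  obtain ⟨s, hs⟩ := Finset.card_eq_one.1
    (show ((((S.erase o).erase p).erase q).erase r).card = 1 by omega)
  have hs' : s ∈ (((S.erase o).erase p).erase q).erase r := by simp [hs]
  have hS : S = {o, p, q, r, s} := by
    rw [← hs, Finset.insert_erase hr, Finset.insert_erase hq, Finset.insert_erase hp,
      Finset.insert_erase ho]
  have hr₁ := Finset.mem_of_mem_erase hr
  have hs₂ := Finset.mem_of_mem_erase hs'
  have hs₁ := Finset.mem_of_mem_erase hs₂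
  have hd : [o, p, q, r, s].Nodup := by
    simp only [Finset.mem_erase] at hp hq hr hs'
    simp only [List.nodup_cons, List.mem_cons, List.not_mem_nil, not_or]
    grind
  exact exists_empty_quadrilateral_of_sorted (by simp [hS]) hcol hd (hp' q hq) (hp' r hr₁)
    (hp' s hs₁) (hq' r hr) (hq' s hs₂) (hr' s hs')
end
end
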